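/- For every polynomial p with complex coefficients and every nonzero real Λ, the trace of the operator p(D̸²/Λ²) on the 24-dimensional space F × F equals 8·p(0) + 16·p(9/Λ²). -/

import Mathlib

noncomputable section
open DihedralGroup Complex

abbrev D6 := DihedralGroup 6
/-- the reflection `s` -/
def s : D6 := DihedralGroup.sr 0
/-- the rotation `r` of order 6 -/
def rot : D6 := DihedralGroup.r 1
/-- `t = s*r` -/
def t : D6 := s * rot
/-- `x = s*r^3` -/
def x : D6 := s * rot ^ 3
/-- `y = s*r^5` -/
def y : D6 := s * rot ^ 5
/-- `F` is the space of complex-valued functions on `D₆`. -/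
abbrev F := D6 → ℂ

/-- The right-translation operator `(R_a f)(g) = f(g·a)`. -/
def R (a : D6) : Module.End ℂ F := LinearMap.funLeft ℂ ℂ (fun g => g * a)

/-- `ω = exp(iπ/3)`. -/
def ω : ℂ := Complex.exp (Real.pi * Complex.I / 3)

/-- `D₀ = R_t + R_x + R_y`. -/
def D₀ : Module.End ℂ F := R t + R x + R y

/-- `D₁ = ω·R_t + ω³·R_x + ω⁵·R_y`. -/
def D₁ : Module.End ℂ F := ω • R t + ω ^ 3 • R x + ω ^ 5 • R y

/-- `D₂ = ω⁻¹·R_t + ω⁻³·R_x + ω⁻⁵·R_y`. -/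
def D₂ : Module.End ℂ F := ω⁻¹ • R t + (ω ^ 3)⁻¹ • R x + (ω ^ 5)⁻¹ • R y

/-- The Dirac operator `D̸(f₁, f₂) = (−D₀f₁ + D₂f₂, D₁f₁ − D₀f₂)` on `F × F`. -/
def Dir : Module.End ℂ (F × F) :=
  LinearMap.prod (D₂ ∘ₗ LinearMap.snd ℂ F F - D₀ ∘ₗ LinearMap.fst ℂ F F)
    (D₁ ∘ₗ LinearMap.fst ℂ F F - D₀ ∘ₗ LinearMap.snd ℂ F F)

lemma omega_sq : ω ^ 2 = ω - 1 := by
  have h : ω = 1 / 2 + (√3 / 2 : ℝ) * I := by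
    have h' : (Real.pi * I / 3 : ℂ) = ((Real.pi / 3 : ℝ) : ℂ) * I := by push_cast; ring
    rw [ω, h', exp_mul_I, ← ofReal_cos, ← ofReal_sin, Real.cos_pi_div_three,
      Real.sin_pi_div_three]
    push_cast
    ring
  have h3 : ((√3 : ℝ) : ℂ) ^ 2 = 3 := by
    rw [← ofReal_pow, Real.sq_sqrt (by norm_num)]
    norm_num
  rw [h]
  push_cast
  linear_combination (1 / 4 : ℂ) * ((√3 : ℝ) : ℂ) ^ 2 * I_sq - (1 / 4 : ℂ) * h3

lemma omega_cube : ω ^ 3 = -1 := by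
  linear_combination (ω + 1) * omega_sq

lemma omega_pow_five : ω ^ 5 = 1 - ω := by
  linear_combination (ω ^ 3 + ω ^ 2 - 1) * omega_sq

lemma omega_inv : ω⁻¹ = 1 - ω :=
  inv_eq_of_mul_eq_one_right <| by linear_combination -omega_sq

lemma omega_pow_five_inv : (ω ^ 5)⁻¹ = ω := by
  rw [omega_pow_five, ← omega_inv, inv_inv]

lemma D₁_eq : D₁ = ω • R t - R x + (1 - ω) • R y := by
  rw [D₁, omega_cube, omega_pow_five]
  module

lemma D₂_eq : D₂ = (1 - ω) • R t - R x + ω • R y := by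
  rw [D₂, omega_cube, omega_pow_five_inv, omega_inv, inv_neg, inv_one]
  module

lemma R_mul_R (a b : D6) : R a * R b = R (a * b) := by
  ext f g
  simp [R, LinearMap.funLeft, mul_assoc]

lemma trace_R (a : D6) : LinearMap.trace ℂ F (R a) = if a = 1 then 12 else 0 := by
  rw [LinearMap.trace_eq_matrix_trace ℂ (Pi.basisFun ℂ D6), Matrix.trace]
  have h (g : D6) : (LinearMap.toMatrix (Pi.basisFun ℂ D6) (Pi.basisFun ℂ D6) (R a)).diag g
      = if a = 1 then 1 else 0 := by
    simp [R, LinearMap.funLeft, Pi.single_apply]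
  simp only [h]
  split_ifs <;> simp [DihedralGroup.card]

/-- The products of two of the reflections `t`, `x`, `y`. -/
lemma reflection_mul :
    t * t = 1 ∧ x * x = 1 ∧ y * y = 1 ∧
    t * x = r 2 ∧ x * y = r 2 ∧ y * t = r 2 ∧ x * t = r 4 ∧ y * x = r 4 ∧ t * y = r 4 := by
  decide

lemma rotation_mul :
    (r 2 : D6) * t = y ∧ (r 2 : D6) * x = t ∧ (r 2 : D6) * y = x ∧
    (r 4 : D6) * t = x ∧ (r 4 : D6) * x = y ∧ (r 4 : D6) * y = t := by
  decide

lemma D₀_mul_D₀ : D₀ * D₀ = (3 : ℂ) • (R 1 + R (r 2) + R (r 4)) := by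
  obtain ⟨h1, h2, h3, h4, h5, h6, h7, h8, h9⟩ := reflection_mul
  simp only [D₀, add_mul, mul_add, R_mul_R, h1, h2, h3, h4, h5, h6, h7, h8, h9]
  module

lemma D₂_mul_D₁ :
    D₂ * D₁ = (3 : ℂ) • R 1 + (3 * (ω - 1)) • R (r 2) - (3 * ω) • R (r 4) := by
  obtain ⟨h1, h2, h3, h4, h5, h6, h7, h8, h9⟩ := reflection_mul
  simp only [D₁_eq, D₂_eq, add_mul, mul_add, sub_mul, mul_sub, smul_mul_assoc, mul_smul_comm,
    R_mul_R, h1, h2, h3, h4, h5, h6, h7, h8, h9]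
  match_scalars <;> grind [omega_sq]

lemma D₁_mul_D₂ :
    D₁ * D₂ = (3 : ℂ) • R 1 - (3 * ω) • R (r 2) + (3 * (ω - 1)) • R (r 4) := by
  obtain ⟨h1, h2, h3, h4, h5, h6, h7, h8, h9⟩ := reflection_mul
  simp only [D₁_eq, D₂_eq, add_mul, mul_add, sub_mul, mul_sub, smul_mul_assoc, mul_smul_comm,
    R_mul_R, h1, h2, h3, h4, h5, h6, h7, h8, h9]
  match_scalars <;> grind [omega_sq]

lemma D₀_mul_D₁ : D₀ * D₁ = 0 := by
  obtain ⟨h1, h2, h3, h4, h5, h6, h7, h8, h9⟩ := reflection_mul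
  simp only [D₀, D₁_eq, add_mul, mul_add, mul_sub, mul_smul_comm,
    R_mul_R, h1, h2, h3, h4, h5, h6, h7, h8, h9]
  module

lemma D₁_mul_D₀ : D₁ * D₀ = 0 := by
  obtain ⟨h1, h2, h3, h4, h5, h6, h7, h8, h9⟩ := reflection_mul
  simp only [D₀, D₁_eq, add_mul, mul_add, sub_mul, smul_mul_assoc,
    R_mul_R, h1, h2, h3, h4, h5, h6, h7, h8, h9]
  module

lemma D₀_mul_D₂ : D₀ * D₂ = 0 := by
  obtain ⟨h1, h2, h3, h4, h5, h6, h7, h8, h9⟩ := reflection_mul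
  simp only [D₀, D₂_eq, add_mul, mul_add, mul_sub, mul_smul_comm,
    R_mul_R, h1, h2, h3, h4, h5, h6, h7, h8, h9]
  module

lemma D₂_mul_D₀ : D₂ * D₀ = 0 := by
  obtain ⟨h1, h2, h3, h4, h5, h6, h7, h8, h9⟩ := reflection_mul
  simp only [D₀, D₂_eq, add_mul, mul_add, sub_mul, smul_mul_assoc,
    R_mul_R, h1, h2, h3, h4, h5, h6, h7, h8, h9]
  module

lemma D₀_mul_D₀_mul_D₀ : D₀ * D₀ * D₀ = (9 : ℂ) • D₀ := by
  obtain ⟨h1, h2, h3, h4, h5, h6⟩ := rotation_mul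
  rw [D₀_mul_D₀]
  simp only [D₀, add_mul, mul_add, smul_mul_assoc,
    R_mul_R, one_mul, h1, h2, h3, h4, h5, h6]
  module

lemma D₂_mul_D₁_mul_D₂ : D₂ * D₁ * D₂ = (9 : ℂ) • D₂ := by
  obtain ⟨h1, h2, h3, h4, h5, h6⟩ := rotation_mul
  rw [D₂_mul_D₁]
  simp only [D₂_eq, add_mul, mul_add, sub_mul, mul_sub, smul_mul_assoc, mul_smul_comm,
    R_mul_R, one_mul, h1, h2, h3, h4, h5, h6]
  match_scalars <;> grind [omega_sq]

lemma D₁_mul_D₂_mul_D₁ : D₁ * D₂ * D₁ = (9 : ℂ) • D₁ := by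
  obtain ⟨h1, h2, h3, h4, h5, h6⟩ := rotation_mul
  rw [D₁_mul_D₂]
  simp only [D₁_eq, add_mul, mul_add, sub_mul, mul_sub, smul_mul_assoc, mul_smul_comm,
    R_mul_R, one_mul, h1, h2, h3, h4, h5, h6]
  match_scalars <;> grind [omega_sq]

lemma Dir_sq : Dir ^ 2 = LinearMap.prodMap (D₀ * D₀ + D₂ * D₁) (D₀ * D₀ + D₁ * D₂) := by
  have h01 (f : F) : D₀ (D₁ f) = 0 := LinearMap.congr_fun D₀_mul_D₁ f
  have h10 (f : F) : D₁ (D₀ f) = 0 := LinearMap.congr_fun D₁_mul_D₀ f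
  have h02 (f : F) : D₀ (D₂ f) = 0 := LinearMap.congr_fun D₀_mul_D₂ f
  have h20 (f : F) : D₂ (D₀ f) = 0 := LinearMap.congr_fun D₂_mul_D₀ f
  refine LinearMap.ext fun f => ?_
  simp [pow_two, Dir, h01, h10, h02, h20, add_comm]

lemma Dir_sq_mul_self : Dir ^ 2 * Dir ^ 2 = (9 : ℂ) • Dir ^ 2 := by
  have hA : (D₀ * D₀ + D₂ * D₁) * (D₀ * D₀ + D₂ * D₁) = (9 : ℂ) • (D₀ * D₀ + D₂ * D₁) := by
    calc _ = D₀ * D₀ * D₀ * D₀ + D₀ * (D₀ * D₂) * D₁ + D₂ * (D₁ * D₀) * D₀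
          + D₂ * D₁ * D₂ * D₁ := by noncomm_ring
      _ = _ := by
        simp [D₀_mul_D₀_mul_D₀, D₀_mul_D₂, D₁_mul_D₀, D₂_mul_D₁_mul_D₂, smul_add]
  have hB : (D₀ * D₀ + D₁ * D₂) * (D₀ * D₀ + D₁ * D₂) = (9 : ℂ) • (D₀ * D₀ + D₁ * D₂) := by
    calc _ = D₀ * D₀ * D₀ * D₀ + D₀ * (D₀ * D₁) * D₂ + D₁ * (D₂ * D₀) * D₀
          + D₁ * D₂ * D₁ * D₂ := by noncomm_ring
      _ = _ := by
        simp [D₀_mul_D₀_mul_D₀, D₀_mul_D₁, D₂_mul_D₀, D₁_mul_D₂_mul_D₁, smul_add]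
  rw [Dir_sq, LinearMap.prodMap_mul, hA, hB, LinearMap.prodMap_smul]

lemma trace_Dir_sq : LinearMap.trace ℂ (F × F) (Dir ^ 2) = 144 := by
  have h2 : (r 2 : D6) ≠ 1 := by decide
  have h4 : (r 4 : D6) ≠ 1 := by decide
  rw [Dir_sq, LinearMap.trace_prodMap', D₀_mul_D₀, D₂_mul_D₁, D₁_mul_D₂]
  simp only [map_add, map_sub, map_smul, trace_R, h2, h4, if_true, if_false, smul_eq_mul]
  norm_num

/-- Polynomial functional calculus for a scalar multiple of an idempotent. -/
lemma aeval_smul_of_isIdempotentElem {K A : Type*} [CommRing K] [Ring A] [Algebra K A] {e : A}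
    (he : IsIdempotentElem e) (c : K) (p : Polynomial K) :
    Polynomial.aeval (c • e) p = p.eval 0 • (1 - e) + p.eval c • e := by
  induction p using Polynomial.induction_on' with
  | add p q hp hq =>
    simp only [map_add, Polynomial.eval_add, hp, hq]
    module
  | monomial n a =>
    rcases n with _ | n
    · simp [Algebra.algebraMap_eq_smul_one, smul_sub]
    · simp [Polynomial.aeval_monomial, smul_pow, he.pow_succ_eq, Algebra.algebraMap_eq_smul_one,
        smul_smul, mul_comm]

/-- Spectral action: for every polynomial `p` and every nonzero real `Λ`, the trace of
`p(D̸²/Λ²)` on the 24-dimensional space `F × F` equals `8·p(0) + 16·p(9/Λ²)`. -/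
theorem spectral_action (p : Polynomial ℂ) (Λ : ℝ) (hΛ : Λ ≠ 0) :
    LinearMap.trace ℂ (F × F) (Polynomial.aeval ((((Λ : ℂ) ^ 2)⁻¹) • (Dir ^ 2)) p) =
      8 * p.eval 0 + 16 * p.eval (9 / (Λ : ℂ) ^ 2) := by
  have he : IsIdempotentElem ((9 : ℂ)⁻¹ • Dir ^ 2) := by
    rw [IsIdempotentElem, smul_mul_smul_comm, Dir_sq_mul_self, smul_smul]
    norm_num
  have hD : ((Λ : ℂ) ^ 2)⁻¹ • Dir ^ 2 = (9 / (Λ : ℂ) ^ 2) • ((9 : ℂ)⁻¹ • Dir ^ 2) := by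
    rw [smul_smul]
    congr 1
    ring
  rw [hD, aeval_smul_of_isIdempotentElem he]
  simp only [map_add, map_sub, map_smul, trace_Dir_sq, LinearMap.trace_one, smul_eq_mul,
    Module.finrank_prod, Module.finrank_fintype_fun_eq_card, DihedralGroup.card]
  push_cast
  ring
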